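/- Let B > 0 be a constant, let μ₊ = 1/(1 + e^{−2B}), and let W ~ Binomial(k, μ₊) for an integer k ≥ 1. Define h : [0,1] → [−B, B] by h(x) = −B if x ≤ 1/(1+e^{2B}); h(x) = −(1/2)·log(1/x − 1) if 1/(1+e^{2B}) < x < μ₊; and h(x) = B if x ≥ μ₊. Then there exists a constant c > 0, depending only on B, such that E[h(W/k)] − B ≤ −c/√k. In particular, for the two-item BTL model with true parameter θ* = [B, −B], the MLE θ̂⁽ᴮ⁾ constrained to Θ_B incurs bias E[θ̂⁽ᴮ⁾₁] − B ≤ −c/√k, so |E[θ̂⁽ᴮ⁾₁] − B| ≥ c/√k. -/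

import Mathlib

open Finset

/-- Probability that `Binomial(k, p) = w`. -/
noncomputable def binomProb (k : ℕ) (p : ℝ) (w : ℕ) : ℝ :=
  (k.choose w : ℝ) * p ^ w * (1 - p) ^ (k - w)

/-- `E[f(W/k)]` for `W ~ Binomial(k, p)`. -/
noncomputable def binomExp (k : ℕ) (p : ℝ) (f : ℝ → ℝ) : ℝ :=
  ∑ w ∈ Finset.range (k + 1), binomProb k p w * f ((w : ℝ) / (k : ℝ))

/-- `μ₊ = 1/(1+e^{-2B})`, the win probability of the stronger item in the
two-item BTL model with parameters `[B, -B]`. -/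
noncomputable def muPlus (B : ℝ) : ℝ := 1 / (1 + Real.exp (-(2 * B)))

/-- First coordinate of the two-item MLE constrained to the box `[-B, B]`, as a
function of the observed win fraction:
`h(x) = -B` for `x ≤ 1/(1+e^{2B})`, `h(x) = -(1/2)log(1/x - 1)` for
`1/(1+e^{2B}) < x < μ₊`, and `h(x) = B` for `x ≥ μ₊`. -/
noncomputable def hFun (B : ℝ) (x : ℝ) : ℝ :=
  if x ≤ 1 / (1 + Real.exp (2 * B)) then -B
  else if x < muPlus B then -(1 / 2) * Real.log (1 / x - 1)
  else B

/-- The piecewise-linear surrogate `h⁺`: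
`h⁺(x) = (2B/p)(x - p) + B` for `x < p` and `h⁺(x) = B` for `x ≥ p`. -/
noncomputable def hPlusFun (B p : ℝ) (x : ℝ) : ℝ :=
  if x < p then 2 * B / p * (x - p) + B else B

/-- Conditioning on the last Bernoulli trial: the expectation of `f W` for a binomial `W` with
`k + 1` trials splits according to the outcome of that trial. -/
lemma sum_binomProb_succ (k : ℕ) (p : ℝ) (f : ℕ → ℝ) :
    ∑ w ∈ range (k + 2), binomProb (k + 1) p w * f w =
      p * ∑ w ∈ range (k + 1), binomProb k p w * f (w + 1) +
        (1 - p) * ∑ w ∈ range (k + 1), binomProb k p w * f w := by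
  have h_last : ∑ w ∈ range (k + 1), binomProb k p w * f w =
      ∑ w ∈ range (k + 2), binomProb k p w * f w := by
    rw [sum_range_succ _ (k + 1)]
    simp [binomProb]
  have h_shift : ∀ w ∈ range (k + 1), binomProb (k + 1) p (w + 1) * f (w + 1) =
      p * (binomProb k p w * f (w + 1)) +
        (1 - p) * (binomProb k p (w + 1) * f (w + 1)) := by
    intro w hw
    have hwk : w ≤ k := Nat.lt_succ_iff.mp (mem_range.mp hw)
    rcases hwk.eq_or_lt with rfl | hlt
    · simp [binomProb]
      ring
    · obtain ⟨m, rfl⟩ := Nat.exists_eq_add_of_lt hlt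
      have e1 : w + m + 1 + 1 - (w + 1) = m + 1 := by omega
      have e2 : w + m + 1 - w = m + 1 := by omega
      have e3 : w + m + 1 - (w + 1) = m := by omega
      simp only [binomProb, Nat.choose_succ_succ, e1, e2, e3]
      push_cast
      ring
  rw [h_last, sum_range_succ', sum_range_succ' _ (k + 1), sum_congr rfl h_shift,
    sum_add_distrib, ← mul_sum, ← mul_sum]
  simp only [binomProb, Nat.choose_zero_right, Nat.sub_zero]
  ring

/-- The total mass and the first four central moments of the binomial distribution. -/
lemma binomProb_central_moments (k : ℕ) (p : ℝ) :
    ∑ w ∈ range (k + 1), binomProb k p w = 1 ∧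
    ∑ w ∈ range (k + 1), binomProb k p w * ((w : ℝ) - k * p) = 0 ∧
    ∑ w ∈ range (k + 1), binomProb k p w * ((w : ℝ) - k * p) ^ 2 = k * (p * (1 - p)) ∧
    ∑ w ∈ range (k + 1), binomProb k p w * ((w : ℝ) - k * p) ^ 3 =
      k * (p * (1 - p)) * (1 - 2 * p) ∧
    ∑ w ∈ range (k + 1), binomProb k p w * ((w : ℝ) - k * p) ^ 4 =
      3 * k ^ 2 * (p * (1 - p)) ^ 2 + k * (p * (1 - p)) * (1 - 6 * (p * (1 - p))) := by
  induction k with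
  | zero => simp [binomProb]
  | succ k ih =>
    obtain ⟨h0, h1, h2, h3, h4⟩ := ih
    have expand (a b c d e : ℝ) : ∑ w ∈ range (k + 1), binomProb k p w *
        (a + b * ((w : ℝ) - k * p) + c * ((w : ℝ) - k * p) ^ 2 + d * ((w : ℝ) - k * p) ^ 3 +
          e * ((w : ℝ) - k * p) ^ 4) =
        a + c * (k * (p * (1 - p))) + d * (k * (p * (1 - p)) * (1 - 2 * p)) +
          e * (3 * k ^ 2 * (p * (1 - p)) ^ 2 +
            k * (p * (1 - p)) * (1 - 6 * (p * (1 - p)))) := by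
      simp only [mul_add, sum_add_distrib, mul_left_comm (binomProb k p _), ← mul_sum, ← sum_mul,
        h0, h1, h2, h3, h4]
      ring
    have step (f : ℕ → ℝ) (a b c d e a' b' c' d' e' : ℝ)
        (hf : ∀ w : ℕ, f (w + 1) = a + b * ((w : ℝ) - k * p) + c * ((w : ℝ) - k * p) ^ 2 +
          d * ((w : ℝ) - k * p) ^ 3 + e * ((w : ℝ) - k * p) ^ 4)
        (hf' : ∀ w : ℕ, f w = a' + b' * ((w : ℝ) - k * p) + c' * ((w : ℝ) - k * p) ^ 2 +
          d' * ((w : ℝ) - k * p) ^ 3 + e' * ((w : ℝ) - k * p) ^ 4) :=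
      (sum_binomProb_succ k p f).trans (by
        rw [sum_congr rfl fun w _ => by rw [hf w], expand a b c d e,
          sum_congr rfl fun w _ => by rw [hf' w], expand a' b' c' d' e'])
    refine ⟨?_, ?_, ?_, ?_, ?_⟩
    · have := step (fun _ => 1) 1 0 0 0 0 1 0 0 0 0 (by intro w; ring) (by intro w; ring)
      simp only [mul_one] at this
      rw [this]
      ring
    · rw [step (fun w => (w : ℝ) - (k + 1 : ℕ) * p) (1 - p) 1 0 0 0 (-p) 1 0 0 0
        (by intro w; push_cast; ring) (by intro w; push_cast; ring)]
      ring
    · rw [step (fun w => ((w : ℝ) - (k + 1 : ℕ) * p) ^ 2) ((1 - p) ^ 2) (2 * (1 - p)) 1 0 0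
        (p ^ 2) (-(2 * p)) 1 0 0
        (by intro w; push_cast; ring) (by intro w; push_cast; ring)]
      push_cast
      ring
    · rw [step (fun w => ((w : ℝ) - (k + 1 : ℕ) * p) ^ 3)
        ((1 - p) ^ 3) (3 * (1 - p) ^ 2) (3 * (1 - p)) 1 0
        (-p ^ 3) (3 * p ^ 2) (-(3 * p)) 1 0
        (by intro w; push_cast; ring) (by intro w; push_cast; ring)]
      push_cast
      ring
    · rw [step (fun w => ((w : ℝ) - (k + 1 : ℕ) * p) ^ 4)
        ((1 - p) ^ 4) (4 * (1 - p) ^ 3) (6 * (1 - p) ^ 2) (4 * (1 - p)) 1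
        (p ^ 4) (-(4 * p ^ 3)) (6 * p ^ 2) (-(4 * p)) 1
        (by intro w; push_cast; ring) (by intro w; push_cast; ring)]
      push_cast
      ring

lemma binomProb_nonneg {p : ℝ} (hp0 : 0 ≤ p) (hp1 : p ≤ 1) (k w : ℕ) : 0 ≤ binomProb k p w := by
  have : 0 ≤ 1 - p := sub_nonneg.mpr hp1
  unfold binomProb
  positivity

/-- A quartic minorant of the positive part. -/
lemma quartic_le_max_zero {a : ℝ} (ha : 0 < a) (y : ℝ) :
    (y + y ^ 2 / a - y ^ 4 / a ^ 3) / 2 ≤ max y 0 := by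
  obtain ⟨t, rfl⟩ : ∃ t, y = a * t := ⟨y / a, by field_simp⟩
  have e : (a * t + (a * t) ^ 2 / a - (a * t) ^ 4 / a ^ 3) / 2 = a * ((t + t ^ 2 - t ^ 4) / 2) := by
    field_simp
  have key : t ^ 2 - t ^ 4 ≤ |t| := by
    have h4 : t ^ 4 = |t| ^ 4 := by rw [pow_abs, abs_of_nonneg (by positivity)]
    rw [← sq_abs t, h4]
    have ht := abs_nonneg t
    rcases le_total |t| 1 with h | h
    · nlinarith [pow_nonneg ht 4]
    · nlinarith [mul_nonneg (sq_nonneg |t|)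
        (mul_nonneg (sub_nonneg.mpr h) (by linarith : 0 ≤ |t| + 1))]
  rw [e, ← mul_zero a, ← mul_max_of_nonneg _ _ ha.le]
  refine mul_le_mul_of_nonneg_left ?_ ha.le
  rcases le_total t 0 with h | h
  · rw [abs_of_nonpos h] at key
    rw [max_eq_right h]
    linarith
  · rw [abs_of_nonneg h] at key
    rw [max_eq_left h]
    linarith

/-- The expected negative part of a centred binomial variable is at least of order `√k`. -/
lemma le_sum_binomProb_mul_max {p : ℝ} (hp0 : 0 ≤ p) (hp1 : p ≤ 1) {k : ℕ} (hk : 1 ≤ k) :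
    p * (1 - p) / 8 * √k ≤
      ∑ w ∈ range (k + 1), binomProb k p w * max ((k : ℝ) * p - w) 0 := by
  obtain ⟨-, h1, h2, -, h4⟩ := binomProb_central_moments k p
  have hk1 : (1 : ℝ) ≤ k := by exact_mod_cast hk
  set s := √(k : ℝ)
  have hs0 : 0 < s := Real.sqrt_pos.mpr (by linarith)
  have hsk : (k : ℝ) = s ^ 2 := (Real.sq_sqrt (by linarith)).symm
  have hmono : ∑ w ∈ range (k + 1), binomProb k p w *
      ((((k : ℝ) * p - w) + ((k : ℝ) * p - w) ^ 2 / (2 * s) -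
        ((k : ℝ) * p - w) ^ 4 / (2 * s) ^ 3) / 2) ≤
      ∑ w ∈ range (k + 1), binomProb k p w * max ((k : ℝ) * p - w) 0 :=
    sum_le_sum fun w _ => mul_le_mul_of_nonneg_left
      (quartic_le_max_zero (by positivity) _) (binomProb_nonneg hp0 hp1 k w)
  refine le_trans ?_ hmono
  have hexpand : ∑ w ∈ range (k + 1), binomProb k p w *
      ((((k : ℝ) * p - w) + ((k : ℝ) * p - w) ^ 2 / (2 * s) -
        ((k : ℝ) * p - w) ^ 4 / (2 * s) ^ 3) / 2) =
      -(1 / 2) * ∑ w ∈ range (k + 1), binomProb k p w * ((w : ℝ) - k * p) +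
      1 / (4 * s) * ∑ w ∈ range (k + 1), binomProb k p w * ((w : ℝ) - k * p) ^ 2 -
      1 / (16 * s ^ 3) * ∑ w ∈ range (k + 1), binomProb k p w * ((w : ℝ) - k * p) ^ 4 := by
    simp only [mul_sum]
    rw [← sum_add_distrib, ← sum_sub_distrib]
    refine sum_congr rfl fun w _ => ?_
    field_simp
    ring
  rw [hexpand, h1, h2, h4, hsk]
  set v := p * (1 - p)
  have hv0 : 0 ≤ v := mul_nonneg hp0 (sub_nonneg.mpr hp1)
  have hv1 : v ≤ 1 / 4 := by nlinarith [sq_nonneg (p - 1 / 2)]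
  have hs1 : 1 ≤ s ^ 2 := hsk ▸ hk1
  have e : -(1 / 2) * 0 + 1 / (4 * s) * (s ^ 2 * v) -
      1 / (16 * s ^ 3) * (3 * (s ^ 2) ^ 2 * v ^ 2 + s ^ 2 * v * (1 - 6 * v)) - v / 8 * s =
      v * (2 * s ^ 2 - 3 * v * s ^ 2 - (1 - 6 * v)) / (16 * s) := by
    field_simp
    ring
  have : 0 ≤ v * (2 * s ^ 2 - 3 * v * s ^ 2 - (1 - 6 * v)) / (16 * s) := by
    refine div_nonneg (mul_nonneg hv0 ?_) (by positivity)
    nlinarith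
  linarith

lemma muPlus_pos (B : ℝ) : 0 < muPlus B := by
  unfold muPlus
  positivity

lemma muPlus_lt_one (B : ℝ) : muPlus B < 1 := by
  unfold muPlus
  rw [div_lt_one (by positivity)]
  linarith [Real.exp_pos (-(2 * B))]

/-- The constrained estimator lies below a function with a corner at `μ₊`. -/
lemma hFun_le {B x : ℝ} (hB : 0 < B) (hx : 0 ≤ x) :
    hFun B x ≤ B - min (1 / 2) (2 * B) * max (muPlus B - x) 0 := by
  have hp0 := muPlus_pos B
  have hp1 := muPlus_lt_one B
  have hC : 0 ≤ min (1 / 2) (2 * B) := le_min (by norm_num) (by linarith)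
  unfold hFun
  split_ifs with h1 h2
  · have : max (muPlus B - x) 0 ≤ 1 := max_le (by linarith) zero_le_one
    nlinarith [min_le_right (1 / 2) (2 * B)]
  · have hx0 : 0 < x := lt_trans (by positivity) (not_le.mp h1)
    have hx1 : x < 1 := h2.trans hp1
    rw [max_eq_left (by linarith)]
    have hexp : Real.exp (-(2 * B)) = 1 / muPlus B - 1 := by
      unfold muPlus
      field_simp
      ring
    have hq : 0 < 1 / muPlus B - 1 := hexp ▸ Real.exp_pos _
    have hr : 0 < 1 / x - 1 := by
      rw [sub_pos, lt_div_iff₀ hx0]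
      linarith
    have hlogp : Real.log (1 / muPlus B - 1) = -(2 * B) := by rw [← hexp, Real.log_exp]
    have hlog := Real.one_sub_inv_le_log_of_pos (div_pos hr hq)
    rw [Real.log_div hr.ne' hq.ne', hlogp] at hlog
    have hd : muPlus B - x ≤ 1 - ((1 / x - 1) / (1 / muPlus B - 1))⁻¹ := by
      have hx1' : 0 < 1 - x := by linarith
      have e : 1 - ((1 / x - 1) / (1 / muPlus B - 1))⁻¹ =
          (muPlus B - x) / (muPlus B * (1 - x)) := by
        rw [inv_div]
        field_simp
        ring
      rw [e, le_div_iff₀ (by positivity)]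
      have : muPlus B * (1 - x) ≤ 1 := by nlinarith
      nlinarith
    nlinarith [min_le_left (1 / 2) (2 * B)]
  · rw [max_eq_right (by linarith)]
    simp

/-- Proposition 1: in the two-item BTL model with
`θ* = [B, -B]`, the constrained MLE `θ̂⁽ᴮ⁾₁ = h(W/k)` with `W ~ Binomial(k, μ₊)`
incurs a negative bias `E[h(W/k)] − B ≤ −c/√k`, and in particular
`|E[h(W/k)] − B| ≥ c/√k`, for a constant `c > 0` depending only on `B`. -/
theorem two_item_mle_negative_bias (B : ℝ) (hB : 0 < B) :
    ∃ c > (0 : ℝ), ∀ k : ℕ, 1 ≤ k →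
      binomExp k (muPlus B) (hFun B) - B ≤ -(c / Real.sqrt k) ∧
      c / Real.sqrt k ≤ |binomExp k (muPlus B) (hFun B) - B| := by
  have hp0 := muPlus_pos B
  have hp1 := muPlus_lt_one B
  set p := muPlus B
  have hC : 0 < min (1 / 2) (2 * B) := lt_min (by norm_num) (by linarith)
  set C := min (1 / 2) (2 * B)
  have hq : 0 < 1 - p := by linarith
  refine ⟨C * (p * (1 - p) / 8), by positivity, fun k hk => ?_⟩
  have hk0 : (0 : ℝ) < k := by exact_mod_cast hk
  have hsum := (binomProb_central_moments k p).1
  have hbound : binomExp k p (hFun B) ≤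
      B - C / k * ∑ w ∈ range (k + 1), binomProb k p w * max ((k : ℝ) * p - w) 0 := by
    calc binomExp k p (hFun B)
        ≤ ∑ w ∈ range (k + 1), binomProb k p w * (B - C * max (p - (w : ℝ) / k) 0) :=
          sum_le_sum fun w _ => mul_le_mul_of_nonneg_left (hFun_le hB (by positivity))
            (binomProb_nonneg hp0.le hp1.le k w)
      _ = ∑ w ∈ range (k + 1), (binomProb k p w * B -
            C / k * (binomProb k p w * max ((k : ℝ) * p - w) 0)) := by
          refine sum_congr rfl fun w _ => ?_
          have e : max ((k : ℝ) * p - w) 0 = k * max (p - (w : ℝ) / k) 0 := by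
            rw [mul_max_of_nonneg _ _ hk0.le, mul_zero, mul_sub, mul_div_cancel₀ _ hk0.ne']
          rw [e]
          field_simp
      _ = _ := by rw [sum_sub_distrib, ← sum_mul, ← mul_sum, hsum, one_mul]
  have hdev := mul_le_mul_of_nonneg_left (le_sum_binomProb_mul_max hp0.le hp1.le hk)
    (by positivity : 0 ≤ C / k)
  have e : C / k * (p * (1 - p) / 8 * √(k : ℝ)) = C * (p * (1 - p) / 8) / √(k : ℝ) := by
    have hs : 0 < √(k : ℝ) := Real.sqrt_pos.mpr hk0
    have hsk : (k : ℝ) = √(k : ℝ) * √(k : ℝ) := (Real.mul_self_sqrt hk0.le).symm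
    rw [div_mul_eq_mul_div, div_eq_div_iff hk0.ne' hs.ne']
    linear_combination -(C * (p * (1 - p) / 8)) * hsk
  have hmain : binomExp k p (hFun B) - B ≤ -(C * (p * (1 - p) / 8) / √(k : ℝ)) := by linarith
  exact ⟨hmain, (le_neg_of_le_neg hmain).trans (neg_le_abs _)⟩
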